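/- Let G be a 3-connected finite simple graph containing edges xy and x'y' whose four endpoints x, y, x', y' are pairwise distinct, such that at least three of the four pairs xx', xy', x'y, yy' are edges of G (i.e., the crossing of xy and x'y' is full or almost full). Let G' be the graph obtained from G by deleting the edges xy and x'y' and adding a new vertex v adjacent exactly to x, y, x', y'. Then G' is 3-connected. -/

import Mathlib

open SimpleGraph

/-- The graph obtained from `G` by deleting the edges `xy` and `x'y'` and adding a new
vertex (`none`) adjacent exactly to `x`, `y`, `x'`, `y'`. -/
def addCrossingVertex {V : Type*} (G : SimpleGraph V) (x y x' y' : V) :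
    SimpleGraph (Option V) :=
  SimpleGraph.map Function.Embedding.some (G.deleteEdges {s(x, y), s(x', y')}) ⊔
    SimpleGraph.fromEdgeSet {s((none : Option V), some x), s(none, some y),
      s(none, some x'), s(none, some y')}

/-- A graph is `k`-connected if it has more than `k` vertices and deleting any set of fewer
than `k` vertices leaves a connected graph. -/
def KConnected {V : Type*} [Fintype V] (k : ℕ) (G : SimpleGraph V) : Prop :=
  k < Fintype.card V ∧
    ∀ S : Finset V, S.card < k → (G.induce ((↑S : Set V)ᶜ)).Connected

/-- Deleting `S` leaves a connected graph iff some vertex lies outside `S` and every predicate that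
is constant along the remaining edges is constant on the remaining vertices. -/
theorem SimpleGraph.connected_induce_compl_iff {V : Type*} (G : SimpleGraph V) (S : Finset V) :
    (G.induce ((↑S : Set V)ᶜ)).Connected ↔
      (∃ w, w ∉ S) ∧ ∀ f : V → Prop,
        (∀ a b, a ∉ S → b ∉ S → G.Adj a b → f a → f b) →
        ∀ a b, a ∉ S → b ∉ S → f a → f b := by
  constructor
  · intro h
    refine ⟨?_, fun f hf a b ha hb hfa => ?_⟩
    · obtain ⟨w, hw⟩ := h.nonempty
      exact ⟨w, by simpa using hw⟩
    · obtain ⟨p⟩ := h.preconnected ⟨a, by simpa using ha⟩ ⟨b, by simpa using hb⟩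
      have key : ∀ {u w : ((↑S : Set V)ᶜ : Set V)},
          (G.induce ((↑S : Set V)ᶜ)).Walk u w → f u → f w := by
        intro u w p
        induction p with
        | nil => exact id
        | @cons u v w huv _ ih =>
          exact fun hu => ih (hf u v (fun h => u.2 h) (fun h => v.2 h) huv hu)
      exact key p hfa
  · rintro ⟨⟨w, hw⟩, h⟩
    have : Nonempty ((↑S : Set V)ᶜ : Set V) := ⟨⟨w, by simpa using hw⟩⟩
    refine ⟨fun a b => ?_⟩
    obtain ⟨_, hb⟩ := h (fun c => ∃ hc : c ∈ (↑S : Set V)ᶜ,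
        (G.induce ((↑S : Set V)ᶜ)).Reachable a ⟨c, hc⟩)
      (fun c d _ hd hcd ⟨hc, hac⟩ =>
        ⟨by simpa using hd, hac.trans (Adj.reachable (by simpa using hcd))⟩)
      a b (fun h => a.2 h) (fun h => b.2 h) ⟨a.2, Reachable.refl _⟩
    exact hb

theorem addCrossingVertex_adj_some {V : Type*} (G : SimpleGraph V) (x y x' y' a b : V) :
    (addCrossingVertex G x y x' y').Adj (some a) (some b) ↔
      G.Adj a b ∧ s(a, b) ≠ s(x, y) ∧ s(a, b) ≠ s(x', y') := by
  simp only [addCrossingVertex, sup_adj, SimpleGraph.map_adj, deleteEdges_adj]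
  simp

theorem addCrossingVertex_adj_none {V : Type*} (G : SimpleGraph V) (x y x' y' a : V) :
    (addCrossingVertex G x y x' y').Adj none (some a) ↔
      a = x ∨ a = y ∨ a = x' ∨ a = y' := by
  simp only [addCrossingVertex, sup_adj, SimpleGraph.map_adj]
  simp

/-- In a 3-connected graph, a predicate that is constant along the edges avoiding `t` and `a` and
agrees at `a` and `b` is constant on the vertices other than `t`. -/
theorem KConnected.forall_of_pair {V : Type*} [Fintype V] [DecidableEq V] {G : SimpleGraph V}
    (h3conn : KConnected 3 G) (t a b : V) (hbt : b ≠ t) (hba : b ≠ a) (f : V → Prop)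
    (hab : f a ↔ f b)
    (hf : ∀ c d, c ≠ t → d ≠ t → c ≠ a → d ≠ a → G.Adj c d → f c → f d) :
    ∀ c d, c ≠ t → d ≠ t → f c → f d := by
  have h := ((G.connected_induce_compl_iff {t, a}).1
    (h3conn.2 _ (Finset.card_le_two.trans_lt (by norm_num)))).2 f (by grind)
  simp only [Finset.mem_insert, Finset.mem_singleton, not_or] at h
  intro c d hc hd hfc
  have h1 := h b
  have h2 := h c
  grind

/-- Deleting the two crossing edges and at most one vertex leaves a connected graph: a predicate
that is constant along the remaining edges is constant on the remaining vertices. -/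
theorem KConnected.forall_of_crossing {V : Type*} [Fintype V] [DecidableEq V]
    {G : SimpleGraph V} (x y x' y' : V)
    (hxy : x ≠ y) (hxx' : x ≠ x') (hxy' : x ≠ y') (hyx' : y ≠ x') (hyy' : y ≠ y')
    (hx'y' : x' ≠ y')
    (hfull : (G.Adj x y' ∧ G.Adj x' y ∧ G.Adj y y') ∨
      (G.Adj x x' ∧ G.Adj x' y ∧ G.Adj y y') ∨
      (G.Adj x x' ∧ G.Adj x y' ∧ G.Adj y y') ∨
      (G.Adj x x' ∧ G.Adj x y' ∧ G.Adj x' y))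
    (h3conn : KConnected 3 G) (T : Finset V) (hT : T.card ≤ 1) (f : V → Prop)
    (hf : ∀ a b, a ∉ T → b ∉ T → G.Adj a b → s(a, b) ≠ s(x, y) → s(a, b) ≠ s(x', y') →
      f a → f b) :
    ∀ a b, a ∉ T → b ∉ T → f a → f b := by
  have hiff : ∀ a b, a ∉ T → b ∉ T → G.Adj a b → s(a, b) ≠ s(x, y) → s(a, b) ≠ s(x', y') →
      (f a ↔ f b) := fun a b ha hb h h1 h2 =>
    ⟨hf a b ha hb h h1 h2, hf b a hb ha h.symm (by rwa [Sym2.eq_swap]) (by rwa [Sym2.eq_swap])⟩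
  simp only [ne_eq, Sym2.eq_iff] at hiff
  clear hf
  have hxx := hiff x x'
  have hxy2 := hiff x y'
  have hyx := hiff x' y
  have hyy := hiff y y'
  by_cases hmem : x ∈ T ∨ y ∈ T ∨ x' ∈ T ∨ y' ∈ T
  · obtain ⟨t, ht⟩ : ∃ t, T = {t} := by
      apply Finset.card_eq_one.1
      have : 0 < T.card := Finset.card_pos.2 (by grind)
      omega
    subst ht
    simp only [Finset.mem_singleton] at *
    have key := h3conn.forall_of_pair t
    rcases hmem with rfl | rfl | rfl | rfl
    · by_cases h : G.Adj x' y
      · exact key x' y (by grind) (by grind) f (by grind) (by grind)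
      · exact key y' y (by grind) (by grind) f (by grind) (by grind)
    · by_cases h : G.Adj x x'
      · exact key x' x (by grind) (by grind) f (by grind) (by grind)
      · exact key y' x (by grind) (by grind) f (by grind) (by grind)
    · by_cases h : G.Adj x y'
      · exact key x y' (by grind) (by grind) f (by grind) (by grind)
      · exact key y y' (by grind) (by grind) f (by grind) (by grind)
    · by_cases h : G.Adj x x'
      · exact key x x' (by grind) (by grind) f (by grind) (by grind)
      · exact key y x' (by grind) (by grind) f (by grind) (by grind)
  · have hsame : (f x ↔ f y) ∧ (f x' ↔ f y') := by grind
    refine ((G.connected_induce_compl_iff T).1 (h3conn.2 T (by omega))).2 f ?_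
    intro a b ha hb hab
    by_cases h1 : a = x ∧ b = y ∨ a = y ∧ b = x
    · obtain ⟨rfl, rfl⟩ | ⟨rfl, rfl⟩ := h1
      · exact hsame.1.1
      · exact hsame.1.2
    by_cases h2 : a = x' ∧ b = y' ∨ a = y' ∧ b = x'
    · obtain ⟨rfl, rfl⟩ | ⟨rfl, rfl⟩ := h2
      · exact hsame.2.1
      · exact hsame.2.2
    exact (hiff a b ha hb hab h1 h2).1

/-- If `G` is 3-connected and the crossing of `xy` and `x'y'` is full or almost full (at
least three of the four pairs `xx'`, `xy'`, `x'y`, `yy'` are edges), then the graph obtained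
by turning the crossing into a new 4-valent vertex is 3-connected. -/
theorem crossing_vertex_three_connected {V : Type*} [Fintype V] [DecidableEq V]
    (G : SimpleGraph V) (x y x' y' : V)
    (hxy : x ≠ y) (hxx' : x ≠ x') (hxy' : x ≠ y') (hyx' : y ≠ x') (hyy' : y ≠ y')
    (hx'y' : x' ≠ y')
    (e1 : G.Adj x y) (e2 : G.Adj x' y')
    (hfull : (G.Adj x y' ∧ G.Adj x' y ∧ G.Adj y y') ∨
      (G.Adj x x' ∧ G.Adj x' y ∧ G.Adj y y') ∨
      (G.Adj x x' ∧ G.Adj x y' ∧ G.Adj y y') ∨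
      (G.Adj x x' ∧ G.Adj x y' ∧ G.Adj x' y))
    (h3conn : KConnected 3 G) :
    KConnected 3 (addCrossingVertex G x y x' y') := by
  refine ⟨by have := h3conn.1; simp only [Fintype.card_option]; omega, fun S hS => ?_⟩
  have hTS : (Finset.eraseNone S).card ≤ S.card := Finset.card_eraseNone_le S
  have hG := (G.connected_induce_compl_iff (Finset.eraseNone S)).1
    (h3conn.2 _ (hTS.trans_lt hS))
  have hmem : ∀ a : V, a ∉ Finset.eraseNone S ↔ some a ∉ S := by simp
  rw [SimpleGraph.connected_induce_compl_iff]
  refine ⟨hG.1.elim fun w hw => ⟨some w, (hmem w).1 hw⟩, fun f hf => ?_⟩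
  have hsome : ∀ a b : V, some a ∉ S → some b ∉ S → f (some a) → f (some b) := by
    intro a b ha hb
    rw [← hmem] at ha hb
    by_cases hn : none ∈ S
    · refine h3conn.forall_of_crossing x y x' y' hxy hxx' hxy' hyx' hyy' hx'y' hfull
        (Finset.eraseNone S) ?_ (fun c => f (some c)) ?_ a b ha hb
      · rw [Finset.card_eraseNone_of_mem hn]
        omega
      · intro c d hc hd hcd h1 h2
        exact hf _ _ ((hmem c).1 hc) ((hmem d).1 hd)
          ((addCrossingVertex_adj_some ..).2 ⟨hcd, h1, h2⟩)
    · refine hG.2 (fun c => f (some c)) ?_ a b ha hb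
      intro c d hc hd hcd hfc
      rw [hmem] at hc hd
      by_cases h : s(c, d) ≠ s(x, y) ∧ s(c, d) ≠ s(x', y')
      · exact hf _ _ hc hd ((addCrossingVertex_adj_some ..).2 ⟨hcd, h⟩) hfc
      · rw [not_and_or, not_not, not_not, Sym2.eq_iff, Sym2.eq_iff] at h
        have hc' := (addCrossingVertex_adj_none G x y x' y' c).2
          (by rcases h with (h | h) | (h | h) <;> simp [h.1])
        have hd' := (addCrossingVertex_adj_none G x y x' y' d).2
          (by rcases h with (h | h) | (h | h) <;> simp [h.2])
        exact hf _ _ hn hd hd' (hf _ _ hc hn hc'.symm hfc)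
  have hnone : none ∉ S → ∃ c : V, some c ∉ S ∧ (f none ↔ f (some c)) := by
    intro hn
    obtain ⟨c, hc, hcS⟩ : ∃ c ∈ ({x, y, x'} : Finset V), c ∉ Finset.eraseNone S := by
      refine Finset.exists_mem_notMem_of_card_lt_card ?_
      rw [Finset.card_eq_three.2 ⟨x, y, x', hxy, hxx', hyx', rfl⟩]
      omega
    have hcS' := (hmem c).1 hcS
    have hc' := (addCrossingVertex_adj_none G x y x' y' c).2 (by
      simp only [Finset.mem_insert, Finset.mem_singleton] at hc
      rcases hc with h | h | h <;> simp [h])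
    exact ⟨c, hcS', hf _ _ hn hcS' hc', hf _ _ hcS' hn hc'.symm⟩
  rintro (_ | a) (_ | b) ha hb hfa
  · exact hfa
  · obtain ⟨c, hc, hiff⟩ := hnone ha
    exact hsome c b hc hb (hiff.1 hfa)
  · obtain ⟨c, hc, hiff⟩ := hnone hb
    exact hiff.2 (hsome a c ha hc hfa)
  · exact hsome a b ha hb hfa
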